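/- arXiv:2603.03139 — 2 statements merged into one kernel-verified Lean document; each statement's English description precedes it below -/
import Mathlib

section
/- Let G = (V,E) be a finite graph with Gallai–Edmonds decomposition GE(G) = (C,A,D), and let G' be obtained from G by deleting every edge incident to a vertex of C (keeping the vertex set V). Write GE(G') = (C',A',D'). Then C' = ∅, A' = A, and ν(G') = ν(G) − |C|/2. -/
open SimpleGraph

variable {V : Type*}

/-- `M` is a set of edges of `G` forming a matching (pairwise disjoint edges). -/
def IsMatchingSet (G : SimpleGraph V) (M : Finset (Sym2 V)) : Prop :=
  (∀ e ∈ M, e ∈ G.edgeSet) ∧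
    ∀ e ∈ M, ∀ f ∈ M, e ≠ f → ∀ v : V, v ∈ e → v ∉ f

/-- The matching number `ν(G)`. -/
noncomputable def matchingNumber (G : SimpleGraph V) : ℕ :=
  sSup {n | ∃ M : Finset (Sym2 V), IsMatchingSet G M ∧ M.card = n}

/-- `ν_G(X,Y)`: the maximum size of a matching of `G` each edge of which has one
endpoint in `X` and one endpoint in `Y`. -/
noncomputable def nuBetween (G : SimpleGraph V) (X Y : Set V) : ℕ :=
  sSup {n | ∃ M : Finset (Sym2 V), IsMatchingSet G M ∧ M.card = n ∧
    ∀ e ∈ M, ∃ x ∈ X, ∃ y ∈ Y, e = s(x, y)}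

/-- The set `D` of the Gallai–Edmonds decomposition: the inessential vertices,
i.e. those missed by some maximum matching. -/
def geD (G : SimpleGraph V) : Set V :=
  {v | ∃ M : Finset (Sym2 V), IsMatchingSet G M ∧ M.card = matchingNumber G ∧ ∀ e ∈ M, v ∉ e}

/-- The set `A` of the Gallai–Edmonds decomposition: vertices outside `D` with a
neighbour in `D`. -/
def geA (G : SimpleGraph V) : Set V :=
  {v | v ∉ geD G ∧ ∃ u ∈ geD G, G.Adj v u}

/-- The set `C` of the Gallai–Edmonds decomposition: the remaining vertices. -/
def geC (G : SimpleGraph V) : Set V :=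
  {v | v ∉ geD G ∧ v ∉ geA G}

/-- `G` is an `s`-connector: any two disjoint vertex sets of size at least `s`
are joined by an edge. -/
def IsConnector (G : SimpleGraph V) (s : ℕ) : Prop :=
  ∀ X Y : Set V, Disjoint X Y → s ≤ X.ncard → s ≤ Y.ncard →
    ∃ x ∈ X, ∃ y ∈ Y, G.Adj x y

/-- `G → (t₁K₂, …, t_qK₂)`: every `q`-colouring of the edges of `G` admits a colour
`j` and a `j`-monochromatic matching of size `t j`. -/
def ArrowsMatch (G : SimpleGraph V) {q : ℕ} (t : Fin q → ℕ) : Prop :=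
  ∀ c : Sym2 V → Fin q, ∃ j : Fin q, ∃ M : Finset (Sym2 V),
    IsMatchingSet G M ∧ M.card = t j ∧ ∀ e ∈ M, c e = j

/-- The induced subgraph `G[S]`, viewed as a graph on the same vertex set. -/
def inducedOn (G : SimpleGraph V) (S : Set V) : SimpleGraph V where
  Adj a b := G.Adj a b ∧ a ∈ S ∧ b ∈ S
  symm := ⟨fun _ _ ⟨h, ha, hb⟩ => ⟨h.symm, hb, ha⟩⟩
  loopless := ⟨fun a h => G.loopless.irrefl a h.1⟩

/-- Remove from `G` every edge incident to `S`. -/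
def removeIncident (G : SimpleGraph V) (S : Set V) : SimpleGraph V where
  Adj a b := G.Adj a b ∧ a ∉ S ∧ b ∉ S
  symm := ⟨fun _ _ ⟨h, ha, hb⟩ => ⟨h.symm, hb, ha⟩⟩
  loopless := ⟨fun a h => G.loopless.irrefl a h.1⟩

/-- The subgraph of `G` consisting of the edges incident to `S`. -/
def incidentSub (G : SimpleGraph V) (S : Set V) : SimpleGraph V where
  Adj a b := G.Adj a b ∧ (a ∈ S ∨ b ∈ S)
  symm := ⟨fun _ _ ⟨h, hs⟩ => ⟨h.symm, hs.symm⟩⟩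
  loopless := ⟨fun a h => G.loopless.irrefl a h.1⟩

/-- The vertex set of the connected component of `v` in `G`. -/
def compSet (G : SimpleGraph V) (v : V) : Set V := {u | G.Reachable u v}

/-- The family of vertex sets of the connected components of `G[S]` meeting `S`. -/
def compsOn (G : SimpleGraph V) (S : Set V) : Set (Set V) :=
  {K | ∃ v ∈ S, K = compSet (inducedOn G S) v}

/-- `G[S]` is factor-critical: for every `v ∈ S` there is a matching of `G[S]`
avoiding `v` and covering all other vertices of `S`. -/
def IsFactorCriticalOn (G : SimpleGraph V) (S : Set V) : Prop :=
  ∀ v ∈ S, ∃ M : Finset (Sym2 V), IsMatchingSet (inducedOn G S) M ∧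
    (∀ e ∈ M, v ∉ e) ∧ ∀ u ∈ S, u ≠ v → ∃ e ∈ M, u ∈ e

/-- The bipartite incidence graph of an indexed (multi)hypergraph. -/
def incGraph {ι : Type*} (E : ι → Set V) : SimpleGraph (V ⊕ ι) where
  Adj x y :=
    (∃ v i, x = Sum.inl v ∧ y = Sum.inr i ∧ v ∈ E i) ∨
    (∃ v i, x = Sum.inr i ∧ y = Sum.inl v ∧ v ∈ E i)
  symm := by
    constructor
    rintro x y (⟨v, i, rfl, rfl, h⟩ | ⟨v, i, rfl, rfl, h⟩)
    · exact Or.inr ⟨v, i, rfl, rfl, h⟩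
    · exact Or.inl ⟨v, i, rfl, rfl, h⟩
  loopless := by
    constructor
    rintro x (⟨v, i, rfl, h, -⟩ | ⟨v, i, rfl, h, -⟩) <;> simp at h

/-- An indexed (multi)hypergraph is a hyperforest if its incidence graph has no cycle. -/
def IsHyperforest {ι : Type*} (E : ι → Set V) : Prop := (incGraph E).IsAcyclic

/-- Index type of the multihypergraph `𝒞(𝒢)` of monochromatic connected components:
a colour together with the vertex set of a component of that colour graph. -/
def CompIdx {q : ℕ} (Gc : Fin q → SimpleGraph V) : Type _ :=
  Σ j : Fin q, {K : Set V // ∃ v : V, K = compSet (Gc j) v}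

/-- The hyperedges of the multihypergraph `𝒞(𝒢)`. -/
def CompEdge {q : ℕ} (Gc : Fin q → SimpleGraph V) : CompIdx Gc → Set V :=
  fun p => (p.2 : Set V)

/-- A coloured graph is acyclic if `𝒞(𝒢)` is a hyperforest. -/
def ColouringAcyclic {q : ℕ} (Gc : Fin q → SimpleGraph V) : Prop :=
  IsHyperforest (CompEdge Gc)

/-- `(G₀, G₁, …, G_q)` is a `q`-multicolouring of `G`: the union of all
(coloured and uncoloured) edge sets is the edge set of `G`. -/
def IsMulticolouring (G G0 : SimpleGraph V) {q : ℕ} (Gc : Fin q → SimpleGraph V) : Prop :=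
  G0 ⊔ (⨆ j, Gc j) = G

/-- The colouring `(G₀, G₁, …, G_q)` of `G` is `S`-proper: the uncoloured edges are
exactly the edges of `G` incident to `S`, and they carry no colour. -/
def IsSProper (G G0 : SimpleGraph V) {q : ℕ} (Gc : Fin q → SimpleGraph V) (S : Set V) : Prop :=
  G0.edgeSet = {e | e ∈ G.edgeSet ∧ ∃ v ∈ S, v ∈ e} ∧
    ∀ j, Disjoint G0.edgeSet (Gc j).edgeSet

/-- The potential `σ_𝒢(T) = r_𝒢(T) - |T|`, where
`r_𝒢(T) = ∑_j |A_j ∩ T| + ∑_j ∑_i (ν(G_j[K_j^i]) - ν(G_j[K_j^i ∖ T]))`,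
the inner sum running over the components `K_j^i` of `G_j[D_j]`. -/
noncomputable def sigmaCol {q : ℕ} (Gc : Fin q → SimpleGraph V) (T : Set V) : ℤ :=
  ((∑ j : Fin q, ((geA (Gc j) ∩ T).ncard : ℤ))
    + ∑ j : Fin q, ∑ᶠ K ∈ compsOn (Gc j) (geD (Gc j)),
        ((matchingNumber (inducedOn (Gc j) K) : ℤ)
          - (matchingNumber (inducedOn (Gc j) (K \ T)) : ℤ)))
    - (T.ncard : ℤ)

/-- `T` is `σ_𝒢`-maximal. -/
def SigmaMaximal {q : ℕ} (Gc : Fin q → SimpleGraph V) (T : Set V) : Prop :=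
  (∀ S : Set V, sigmaCol Gc S ≤ sigmaCol Gc T) ∧
    ∀ T' : Set V, T ⊂ T' → sigmaCol Gc T' < sigmaCol Gc T

theorem bddAbove_card_isMatchingSet [Finite V] (G : SimpleGraph V) :
    BddAbove {n | ∃ M : Finset (Sym2 V), IsMatchingSet G M ∧ M.card = n} := by
  have := Fintype.ofFinite (Sym2 V)
  exact ⟨Fintype.card (Sym2 V), by rintro n ⟨M, -, rfl⟩; exact M.card_le_univ⟩

theorem IsMatchingSet.card_le_matchingNumber [Finite V] {G : SimpleGraph V}
    {M : Finset (Sym2 V)} (hM : IsMatchingSet G M) : M.card ≤ matchingNumber G :=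
  le_csSup (bddAbove_card_isMatchingSet G) ⟨M, hM, rfl⟩

theorem exists_isMatchingSet_card_eq_matchingNumber [Finite V] (G : SimpleGraph V) :
    ∃ M : Finset (Sym2 V), IsMatchingSet G M ∧ M.card = matchingNumber G :=
  Nat.sSup_mem (s := {n | ∃ M : Finset (Sym2 V), IsMatchingSet G M ∧ M.card = n})
    ⟨0, ∅, by simp [IsMatchingSet]⟩ (bddAbove_card_isMatchingSet G)

theorem IsMatchingSet.eq_of_mem {G : SimpleGraph V} {M : Finset (Sym2 V)}
    (hM : IsMatchingSet G M) {e f : Sym2 V} (he : e ∈ M) (hf : f ∈ M) {v : V}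
    (hve : v ∈ e) (hvf : v ∈ f) : e = f := by
  by_contra h
  exact hM.2 e he f hf h v hve hvf

theorem IsMatchingSet.mono {G : SimpleGraph V} {M N : Finset (Sym2 V)}
    (hM : IsMatchingSet G M) (h : N ⊆ M) : IsMatchingSet G N :=
  ⟨fun e he => hM.1 e (h he), fun e he f hf => hM.2 e (h he) f (h hf)⟩

theorem IsMatchingSet.union [DecidableEq V] {G : SimpleGraph V} {M N : Finset (Sym2 V)}
    (hM : IsMatchingSet G M) (hN : IsMatchingSet G N)
    (h : ∀ e ∈ M, ∀ f ∈ N, ∀ v ∈ e, v ∉ f) : IsMatchingSet G (M ∪ N) := by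
  refine ⟨fun e he => ?_, fun e he f hf hef v hve hvf => ?_⟩
  · rcases Finset.mem_union.1 he with he | he
    exacts [hM.1 e he, hN.1 e he]
  · rcases Finset.mem_union.1 he with he | he <;> rcases Finset.mem_union.1 hf with hf | hf
    exacts [hM.2 e he f hf hef v hve hvf, h e he f hf v hve hvf, h f hf e he v hvf hve,
      hN.2 e he f hf hef v hve hvf]

/-- Replacing a matching edge `zx` by an edge `xy` to an uncovered vertex `y`. -/
theorem IsMatchingSet.exchange [DecidableEq V] {G : SimpleGraph V} {M : Finset (Sym2 V)}
    (hM : IsMatchingSet G M) {x y z : V} (hzx : s(z, x) ∈ M) (hxy : G.Adj x y)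
    (hy : ∀ e ∈ M, y ∉ e) :
    IsMatchingSet G (insert s(x, y) (M.erase s(z, x))) ∧
      (insert s(x, y) (M.erase s(z, x))).card = M.card ∧
      ∀ e ∈ insert s(x, y) (M.erase s(z, x)), z ∉ e := by
  have hadj : G.Adj z x := hM.1 _ hzx
  have hyz : z ≠ y := fun h => hy _ hzx (by simp [h])
  have hfree : ∀ v ∈ s(x, y), ∀ e ∈ M.erase s(z, x), v ∉ e := by
    intro v hv e he hve
    rw [Finset.mem_erase] at he
    rcases Sym2.mem_iff.1 hv with rfl | rfl
    · exact he.1 (hM.eq_of_mem he.2 hzx hve (by simp))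
    · exact hy e he.2 hve
  refine ⟨?_, ?_, ?_⟩
  · rw [Finset.insert_eq]
    refine IsMatchingSet.union ?_ (hM.mono (Finset.erase_subset _ _)) ?_
    · exact ⟨by simpa using hxy, by simp⟩
    · intro e he f hf v hv
      rw [Finset.mem_singleton] at he
      exact hfree v (he ▸ hv) f hf
  · rw [Finset.card_insert_of_notMem fun h => hfree x (by simp) _ h (by simp),
      Finset.card_erase_add_one hzx]
  · intro e he hze
    rcases Finset.mem_insert.1 he with rfl | he
    · rcases Sym2.mem_iff.1 hze with h | h
      exacts [hadj.ne h, hyz h]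
    · rw [Finset.mem_erase] at he
      exact he.1 (hM.eq_of_mem he.2 hzx hze (by simp))

/-- A vertex missed by some maximum matching `N` can be exposed from any maximum matching `M`
while keeping the edges common to `M` and `N` and a given edge of `M` that avoids `geD G`. -/
theorem exists_maximum_matching_missing [Finite V] [DecidableEq V] {G : SimpleGraph V}
    {M : Finset (Sym2 V)} (hM : IsMatchingSet G M) (hMc : M.card = matchingNumber G)
    {e : Sym2 V} (he : e ∈ M) (heD : ∀ v ∈ e, v ∉ geD G) {N : Finset (Sym2 V)}
    (hN : IsMatchingSet G N) (hNc : N.card = matchingNumber G) {d : V} (hd : ∀ f ∈ N, d ∉ f) :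
    ∃ M' : Finset (Sym2 V), IsMatchingSet G M' ∧ M'.card = matchingNumber G ∧
      (∀ f ∈ M', d ∉ f) ∧ e ∈ M' ∧ M ∩ N ⊆ M' := by
  induction hk : (M \ N).card using Nat.strong_induction_on generalizing N d with
  | _ k ih =>
  by_cases hdM : ∀ f ∈ M, d ∉ f
  · exact ⟨M, hM, hMc, hdM, he, Finset.inter_subset_left⟩
  push Not at hdM
  obtain ⟨f, hfM, hdf⟩ := hdM
  obtain ⟨x, rfl⟩ := Sym2.mem_iff_exists.1 hdf
  have hdx : G.Adj d x := hM.1 _ hfM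
  have hxN : ∃ f ∈ N, x ∈ f := by
    by_contra! hx
    have hins : IsMatchingSet G ({s(d, x)} ∪ N) := by
      refine IsMatchingSet.union ⟨by simpa using hdx, by simp⟩ hN ?_
      intro f hf g hg v hv
      rw [Finset.mem_singleton] at hf
      subst hf
      rcases Sym2.mem_iff.1 hv with rfl | rfl
      exacts [hd g hg, hx g hg]
    have hle := hins.card_le_matchingNumber
    rw [← Finset.insert_eq, Finset.card_insert_of_notMem fun h => hd _ h (by simp)] at hle
    omega
  obtain ⟨f, hfN, hxf⟩ := hxN
  obtain ⟨y, rfl⟩ := Sym2.mem_iff_exists.1 hxf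
  have hxy : G.Adj x y := hN.1 _ hfN
  have hyd : y ≠ d := fun h => hd _ hfN (by simp [h])
  have hyx : s(y, x) ∈ N := Sym2.eq_swap ▸ hfN
  have hyxM : s(y, x) ∉ M := fun h => by
    have := hM.eq_of_mem h hfM (v := x) (by simp) (by simp)
    simp [hyd, hxy.ne'] at this
  obtain ⟨hN', hN'c, hyN'⟩ := hN.exchange hyx hdx.symm hd
  set N' := insert s(x, d) (N.erase s(y, x)) with hN'def
  have hsub : M ∩ N ⊆ M ∩ N' := by
    intro g hg
    rw [Finset.mem_inter] at hg ⊢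
    refine ⟨hg.1, Finset.mem_insert_of_mem (Finset.mem_erase.2 ⟨?_, hg.2⟩)⟩
    rintro rfl
    exact hyxM hg.1
  have hdxN' : s(d, x) ∈ M ∩ N' := by
    rw [Finset.mem_inter]
    exact ⟨hfM, by rw [hN'def, Sym2.eq_swap]; exact Finset.mem_insert_self _ _⟩
  have hdxN : s(d, x) ∉ N := fun h => hd _ h (by simp)
  have hlt : (M \ N').card < k := by
    rw [← hk]
    refine Finset.card_lt_card ⟨fun g hg => ?_, fun h => ?_⟩
    · rw [Finset.mem_sdiff] at hg ⊢
      exact ⟨hg.1, fun h => hg.2 (Finset.mem_inter.1 (hsub (Finset.mem_inter.2 ⟨hg.1, h⟩))).2⟩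
    · exact (Finset.mem_sdiff.1 (h (Finset.mem_sdiff.2 ⟨hfM, hdxN⟩))).2
        (Finset.mem_inter.1 hdxN').2
  obtain ⟨M', hM', hM'c, hyM', heM', hsubM'⟩ := ih _ hlt hN' (hN'c.trans hNc) hyN' rfl
  obtain ⟨hM2, hM2c, hdM2⟩ := hM'.exchange (hsubM' hdxN') hxy hyM'
  refine ⟨_, hM2, hM2c.trans hM'c, hdM2, ?_, fun g hg => ?_⟩
  · refine Finset.mem_insert_of_mem (Finset.mem_erase.2 ⟨?_, heM'⟩)
    rintro rfl
    exact heD d (by simp) ⟨N, hN, hNc, hd⟩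
  · refine Finset.mem_insert_of_mem (Finset.mem_erase.2 ⟨?_, hsubM' (hsub hg)⟩)
    rintro rfl
    exact hdxN (Finset.mem_inter.1 hg).2

/-- In a maximum matching, the edge at a vertex of `geC G` stays within `geC G`. -/
theorem mem_geC_of_maximum_matching [Finite V] {G : SimpleGraph V}
    {M : Finset (Sym2 V)} (hM : IsMatchingSet G M) (hMc : M.card = matchingNumber G)
    {a c : V} (hca : s(c, a) ∈ M) (hc : c ∈ geC G) : a ∈ geC G := by
  classical
  have hadj : G.Adj c a := hM.1 _ hca
  have haD : a ∉ geD G := fun h => hc.2 ⟨hc.1, a, h, hadj⟩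
  refine ⟨haD, ?_⟩
  rintro ⟨-, d, ⟨N, hN, hNc, hd⟩, had⟩
  obtain ⟨M', hM', hM'c, hdM', heM', -⟩ := exists_maximum_matching_missing hM hMc hca
    (by simp [hc.1, haD]) hN hNc hd
  obtain ⟨hM2, hM2c, hcM2⟩ := hM'.exchange heM' had hdM'
  exact hc.1 ⟨_, hM2, hM2c.trans hM'c, hcM2⟩

/-- The number of vertices covered by a matching is twice its size. -/
theorem IsMatchingSet.ncard_covered {G : SimpleGraph V} {M : Finset (Sym2 V)}
    (hM : IsMatchingSet G M) : {v | ∃ e ∈ M, v ∈ e}.ncard = 2 * M.card := by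
  classical
  have hcov : {v | ∃ e ∈ M, v ∈ e} = (M.biUnion Sym2.toFinset : Set V) := by
    ext v
    simp
  rw [hcov, Set.ncard_coe_finset, Finset.card_biUnion, Finset.sum_congr rfl (g := fun _ => 2),
    Finset.sum_const, smul_eq_mul, mul_comm]
  · exact fun e he => Sym2.card_toFinset_of_not_isDiag e (G.not_isDiag_of_mem_edgeSet (hM.1 e he))
  · intro e he f hf hef
    refine Finset.disjoint_left.2 fun v hve hvf => ?_
    exact hM.2 e he f hf hef v (Sym2.mem_toFinset.1 hve) (Sym2.mem_toFinset.1 hvf)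

theorem mem_edgeSet_removeIncident {G : SimpleGraph V} {S : Set V} {e : Sym2 V} :
    e ∈ (removeIncident G S).edgeSet ↔ e ∈ G.edgeSet ∧ ∀ v ∈ e, v ∉ S := by
  induction e with
  | _ a b => simp [removeIncident]

theorem isMatchingSet_removeIncident_iff {G : SimpleGraph V} {S : Set V}
    {M : Finset (Sym2 V)} :
    IsMatchingSet (removeIncident G S) M ↔
      IsMatchingSet G M ∧ ∀ e ∈ M, ∀ v ∈ e, v ∉ S := by
  simp only [IsMatchingSet, mem_edgeSet_removeIncident]
  grind

/-- Every maximum matching contains `|C| / 2` edges that cover exactly the vertices of `geC G`. -/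
theorem exists_subset_covering_geC [Finite V] {G : SimpleGraph V}
    {M : Finset (Sym2 V)} (hM : IsMatchingSet G M) (hMc : M.card = matchingNumber G) :
    ∃ P ⊆ M, (∀ v, v ∈ geC G ↔ ∃ e ∈ P, v ∈ e) ∧ 2 * P.card = (geC G).ncard := by
  classical
  have hcov : ∀ v, v ∈ geC G ↔ ∃ e ∈ M.filter (fun e => ∃ v ∈ e, v ∈ geC G), v ∈ e := by
    intro v
    constructor
    · intro hv
      by_contra! h
      exact hv.1 ⟨M, hM, hMc, fun e he hve =>
        h e (Finset.mem_filter.2 ⟨he, v, hve, hv⟩) hve⟩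
    · rintro ⟨e, he, hve⟩
      obtain ⟨heM, c, hce, hc⟩ := Finset.mem_filter.1 he
      obtain ⟨a, rfl⟩ := Sym2.mem_iff_exists.1 hce
      rcases Sym2.mem_iff.1 hve with rfl | rfl
      exacts [hc, mem_geC_of_maximum_matching hM hMc heM hc]
  refine ⟨_, Finset.filter_subset _ _, hcov, ?_⟩
  rw [← (hM.mono (Finset.filter_subset _ _)).ncard_covered]
  exact congrArg Set.ncard (Set.ext fun v => (hcov v).symm)

/-- Removing from a maximum matching the edges at `geC G` gives a matching of the graph with
`geC G` isolated. -/
theorem exists_isMatchingSet_removeIncident_geC [Finite V] {G : SimpleGraph V}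
    {M : Finset (Sym2 V)} (hM : IsMatchingSet G M) (hMc : M.card = matchingNumber G) :
    ∃ N ⊆ M, IsMatchingSet (removeIncident G (geC G)) N ∧
      2 * N.card + (geC G).ncard = 2 * matchingNumber G := by
  classical
  obtain ⟨P, hPM, hP, hPc⟩ := exists_subset_covering_geC hM hMc
  refine ⟨M \ P, Finset.sdiff_subset, isMatchingSet_removeIncident_iff.2
    ⟨hM.mono Finset.sdiff_subset, fun e he v hve hv => ?_⟩, ?_⟩
  · rw [Finset.mem_sdiff] at he
    obtain ⟨f, hfP, hvf⟩ := (hP v).1 hv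
    exact he.2 (hM.eq_of_mem he.1 (hPM hfP) hve hvf ▸ hfP)
  · have := Finset.card_sdiff_add_card_eq_card hPM
    omega

/-- A matching of the graph with `geC G` isolated extends to a matching of `G` by adding edges
inside `geC G` that cover it. -/
theorem IsMatchingSet.exists_extend_geC [Finite V] {G : SimpleGraph V}
    {N : Finset (Sym2 V)} (hN : IsMatchingSet (removeIncident G (geC G)) N) :
    ∃ M, IsMatchingSet G M ∧ 2 * M.card = 2 * N.card + (geC G).ncard ∧
      ∀ e ∈ M, e ∈ N ∨ ∀ v ∈ e, v ∈ geC G := by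
  classical
  obtain ⟨M, hM, hMc⟩ := exists_isMatchingSet_card_eq_matchingNumber G
  obtain ⟨P, hPM, hP, hPc⟩ := exists_subset_covering_geC hM hMc
  obtain ⟨hNG, hNC⟩ := isMatchingSet_removeIncident_iff.1 hN
  have hfree : ∀ e ∈ N, ∀ f ∈ P, ∀ v ∈ e, v ∉ f := fun e he f hf v hve hvf =>
    hNC e he v hve ((hP v).2 ⟨f, hf, hvf⟩)
  refine ⟨N ∪ P, hNG.union (hM.mono hPM) hfree, ?_, fun e he => ?_⟩
  · rw [Finset.card_union_of_disjoint, mul_add, hPc]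
    refine Finset.disjoint_left.2 fun e heN heP => ?_
    exact hfree e heN e heP _ e.out_fst_mem e.out_fst_mem
  · exact (Finset.mem_union.1 he).imp_right fun he v hve => (hP v).2 ⟨e, he, hve⟩

theorem two_mul_matchingNumber_removeIncident_geC_add [Finite V] (G : SimpleGraph V) :
    2 * matchingNumber (removeIncident G (geC G)) + (geC G).ncard = 2 * matchingNumber G := by
  obtain ⟨M, hM, hMc⟩ := exists_isMatchingSet_card_eq_matchingNumber G
  obtain ⟨N, -, hN, hNc⟩ := exists_isMatchingSet_removeIncident_geC hM hMc
  obtain ⟨N', hN', hN'c⟩ :=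
    exists_isMatchingSet_card_eq_matchingNumber (removeIncident G (geC G))
  obtain ⟨M', hM', hM'c, -⟩ := hN'.exists_extend_geC
  have := hN.card_le_matchingNumber
  have := hM'.card_le_matchingNumber
  omega

theorem geD_removeIncident_geC [Finite V] (G : SimpleGraph V) :
    geD (removeIncident G (geC G)) = geD G ∪ geC G := by
  have hν := two_mul_matchingNumber_removeIncident_geC_add G
  ext v
  constructor
  · rintro ⟨N, hN, hNc, hv⟩
    obtain ⟨M, hM, hMc, hMN⟩ := hN.exists_extend_geC
    by_cases hvC : v ∈ geC G
    · exact Or.inr hvC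
    · exact Or.inl ⟨M, hM, by omega, fun e he hve =>
        (hMN e he).elim (fun h => hv e h hve) fun h => hvC (h v hve)⟩
  · rintro (⟨M, hM, hMc, hv⟩ | hv)
    · obtain ⟨N, hNM, hN, hNc⟩ := exists_isMatchingSet_removeIncident_geC hM hMc
      exact ⟨N, hN, by omega, fun e he => hv e (hNM he)⟩
    · obtain ⟨N, hN, hNc⟩ :=
        exists_isMatchingSet_card_eq_matchingNumber (removeIncident G (geC G))
      exact ⟨N, hN, hNc, fun e he hve =>
        (isMatchingSet_removeIncident_iff.1 hN).2 e he v hve hv⟩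

theorem geA_removeIncident_geC [Finite V] (G : SimpleGraph V) :
    geA (removeIncident G (geC G)) = geA G := by
  ext v
  simp only [geA, geD_removeIncident_geC, Set.mem_ofPred_eq, Set.mem_union, not_or]
  constructor
  · rintro ⟨⟨hvD, -⟩, u, hu, huv, -, huC⟩
    exact ⟨hvD, u, hu.resolve_right huC, huv⟩
  · rintro ⟨hvD, u, hu, huv⟩
    have hvC : v ∉ geC G := fun h => h.2 ⟨hvD, u, hu, huv⟩
    exact ⟨⟨hvD, hvC⟩, u, Or.inl hu, huv, hvC, fun h => h.1 hu⟩

theorem geC_removeIncident_geC [Finite V] (G : SimpleGraph V) :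
    geC (removeIncident G (geC G)) = ∅ := by
  refine Set.eq_empty_iff_forall_notMem.2 fun v hv => ?_
  rw [geC, geD_removeIncident_geC, geA_removeIncident_geC] at hv
  exact hv.1 (Or.inr ⟨fun h => hv.1 (Or.inl h), hv.2⟩)

/-- **Lemma 2.5 (`C`-isolation).** If `GE(G) = (C, A, D)` and `G'` is obtained from `G` by
deleting every edge incident to `C`, then, writing `GE(G') = (C', A', D')`, we have
`C' = ∅`, `A' = A` and `ν(G') = ν(G) - |C|/2` (stated as `2ν(G') = 2ν(G) - |C|`). -/
theorem C_isolation {V : Type*} [Fintype V] (G : SimpleGraph V) :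
    geC (removeIncident G (geC G)) = ∅ ∧
    geA (removeIncident G (geC G)) = geA G ∧
    (2 * (matchingNumber (removeIncident G (geC G)) : ℤ)
      = 2 * (matchingNumber G : ℤ) - ((geC G).ncard : ℤ)) := by
  refine ⟨geC_removeIncident_geC G, geA_removeIncident_geC G, ?_⟩
  have := two_mul_matchingNumber_removeIncident_geC_add G
  omega
end

section
/- Let 𝒢 be a proper acyclic q-multicolouring of a finite graph G = (V,E), and assume G is an s-connector. Then 𝒞(𝒢) contains at most one hyperedge of size greater than s + 1. -/
open SimpleGraph

variable {V : Type*}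

/-- A hyperforest has at most one vertex in common between two distinct hyperedges. -/
theorem IsHyperforest.eq_of_mem_inter {V ι : Type*} {E : ι → Set V} (hE : IsHyperforest E)
    {i k : ι} (hik : i ≠ k) {v w : V} (hvi : v ∈ E i) (hvk : v ∈ E k) (hwi : w ∈ E i)
    (hwk : w ∈ E k) : v = w := by
  have path : ∀ u, u ∈ E i → u ∈ E k → ∃ p : (incGraph E).Walk (Sum.inr i) (Sum.inr k),
      p.IsPath ∧ p.support = [Sum.inr i, Sum.inl u, Sum.inr k] := by
    intro u hi hk
    have h₁ : (incGraph E).Adj (Sum.inr i) (Sum.inl u) := Or.inr ⟨u, i, rfl, rfl, hi⟩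
    have h₂ : (incGraph E).Adj (Sum.inl u) (Sum.inr k) := Or.inl ⟨u, k, rfl, rfl, hk⟩
    refine ⟨.cons h₁ (.cons h₂ .nil), ?_, by simp⟩
    simp [Walk.isPath_def, hik]
  obtain ⟨p, hp, hps⟩ := path v hvi hvk
  obtain ⟨r, hr, hrs⟩ := path w hwi hwk
  have hpr : p = r := congrArg Subtype.val
    ((hE.subsingleton_path _ _).elim ⟨p, hp⟩ ⟨r, hr⟩)
  rw [hpr, hrs] at hps
  simpa using hps.symm

/-- In a hyperforest, two hyperedges are linked through a third hyperedge only via a unique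
vertex of the first. -/
theorem IsHyperforest.eq_of_link {V ι : Type*} {E : ι → Set V} (hE : IsHyperforest E)
    {i k : ι} (hik : i ≠ k) {x y x' y' : V} {m m' : ι}
    (hx : x ∈ E i \ E k) (hy : y ∈ E k \ E i) (hxm : x ∈ E m) (hym : y ∈ E m)
    (hx' : x' ∈ E i \ E k) (hy' : y' ∈ E k \ E i) (hxm' : x' ∈ E m') (hym' : y' ∈ E m') :
    x = x' := by
  have path : ∀ u w n, u ∈ E i \ E k → w ∈ E k \ E i → u ∈ E n → w ∈ E n →
      ∃ p : (incGraph E).Walk (Sum.inr i) (Sum.inr k),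
        p.IsPath ∧ p.support = [Sum.inr i, Sum.inl u, Sum.inr n, Sum.inl w, Sum.inr k] := by
    intro u w n hu hw hun hwn
    have h₁ : (incGraph E).Adj (Sum.inr i) (Sum.inl u) := Or.inr ⟨u, i, rfl, rfl, hu.1⟩
    have h₂ : (incGraph E).Adj (Sum.inl u) (Sum.inr n) := Or.inl ⟨u, n, rfl, rfl, hun⟩
    have h₃ : (incGraph E).Adj (Sum.inr n) (Sum.inl w) := Or.inr ⟨w, n, rfl, rfl, hwn⟩
    have h₄ : (incGraph E).Adj (Sum.inl w) (Sum.inr k) := Or.inl ⟨w, k, rfl, rfl, hw.1⟩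
    have hin : i ≠ n := by rintro rfl; exact hw.2 hwn
    have hnk : n ≠ k := by rintro rfl; exact hu.2 hun
    have huw : u ≠ w := by rintro rfl; exact hu.2 hw.1
    refine ⟨.cons h₁ (.cons h₂ (.cons h₃ (.cons h₄ .nil))), ?_, by simp⟩
    simp [Walk.isPath_def, hik, hin, hnk, huw]
  obtain ⟨p, hp, hps⟩ := path x y m hx hy hxm hym
  obtain ⟨r, hr, hrs⟩ := path x' y' m' hx' hy' hxm' hym'
  have hpr : p = r := congrArg Subtype.val
    ((hE.subsingleton_path _ _).elim ⟨p, hp⟩ ⟨r, hr⟩)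
  rw [hpr, hrs] at hps
  simp only [List.cons.injEq, Sum.inl.injEq] at hps
  exact hps.2.1.symm

/-- A vertex in a component with at least two vertices has a neighbour. -/
theorem exists_adj_of_mem_compSet {V : Type*} {H : SimpleGraph V} {v x : V}
    (hx : x ∈ compSet H v) (hcard : 1 < (compSet H v).ncard) : ∃ u, H.Adj x u := by
  obtain ⟨u, hu, hux⟩ := Set.exists_ne_of_one_lt_ncard hcard x
  obtain ⟨p⟩ : H.Reachable x u := Reachable.trans hx (Reachable.symm hu)
  cases p with
  | nil => exact absurd rfl hux
  | cons h _ => exact ⟨_, h⟩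

/-- In an `S`-proper multicolouring, a component with at least two vertices avoids `S`. -/
theorem IsSProper.notMem_of_mem_compEdge {V : Type*} {q : ℕ} {G G0 : SimpleGraph V}
    {Gc : Fin q → SimpleGraph V} {S : Set V} (hS : IsSProper G G0 Gc S)
    (hcol : IsMulticolouring G G0 Gc) {p : CompIdx Gc} (hp : 1 < (CompEdge Gc p).ncard)
    {x : V} (hx : x ∈ CompEdge Gc p) : x ∉ S := by
  intro hxS
  obtain ⟨j, K, v, rfl⟩ := p
  obtain ⟨u, hu⟩ := exists_adj_of_mem_compSet hx hp
  have hG : G.Adj x u := by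
    rw [← hcol]
    exact Or.inr (by simpa using ⟨j, hu⟩)
  have h0 : s(x, u) ∈ G0.edgeSet := by
    rw [hS.1]
    exact ⟨hG, x, hxS, by simp⟩
  exact Set.disjoint_left.mp (hS.2 j) h0 hu

/-- In an `S`-proper multicolouring, an edge avoiding `S` lies inside a hyperedge. -/
theorem IsSProper.exists_compEdge {V : Type*} {q : ℕ} {G G0 : SimpleGraph V}
    {Gc : Fin q → SimpleGraph V} {S : Set V} (hS : IsSProper G G0 Gc S)
    (hcol : IsMulticolouring G G0 Gc) {x y : V} (hxy : G.Adj x y) (hx : x ∉ S) (hy : y ∉ S) :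
    ∃ p : CompIdx Gc, x ∈ CompEdge Gc p ∧ y ∈ CompEdge Gc p := by
  rw [← hcol] at hxy
  rcases hxy with h0 | hc
  · have h : s(x, y) ∈ G0.edgeSet := h0
    rw [hS.1] at h
    obtain ⟨-, v, hv, hmem⟩ := h
    rcases Sym2.mem_iff.mp hmem with rfl | rfl
    · exact absurd hv hx
    · exact absurd hv hy
  · obtain ⟨j, hj⟩ := SimpleGraph.iSup_adj.mp hc
    exact ⟨⟨j, compSet (Gc j) y, y, rfl⟩, hj.reachable, Reachable.refl y⟩

/-- Two hyperedges sharing at most one vertex lose at most one vertex in their difference. -/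
theorem IsHyperforest.ncard_le_ncard_diff_add_one {V ι : Type*} [Finite V] {E : ι → Set V}
    (hE : IsHyperforest E) {i k : ι} (hik : i ≠ k) :
    (E i).ncard ≤ (E i \ E k).ncard + 1 := by
  have h : (E i ∩ E k).ncard ≤ 1 := (Set.ncard_le_one (Set.toFinite _)).mpr
    fun _ ha _ hb => hE.eq_of_mem_inter hik ha.1 ha.2 hb.1 hb.2
  have := Set.ncard_inter_add_ncard_sdiff_eq_ncard (E i) (E k)
  omega

/-- **Corollary 3.5 (unique large component).** If `𝒢` is a proper acyclic
`q`-multicolouring of `G` and `G` is an `s`-connector, then `𝒞(𝒢)` has at most one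
hyperedge of size greater than `s + 1`. -/
theorem unique_large_component {V : Type*} [Fintype V] {q s : ℕ} (G G0 : SimpleGraph V)
    (Gc : Fin q → SimpleGraph V) (hcol : IsMulticolouring G G0 Gc)
    (hproper : ∃ S : Set V, IsSProper G G0 Gc S)
    (hacyc : ColouringAcyclic Gc)
    (hG : IsConnector G s) :
    ∀ p₁ p₂ : CompIdx Gc, s + 1 < (CompEdge Gc p₁).ncard → s + 1 < (CompEdge Gc p₂).ncard →
      p₁ = p₂ := by
  obtain ⟨S, hS⟩ := hproper
  intro p₁ p₂ h₁ h₂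
  by_contra hne
  have hE : IsHyperforest (CompEdge Gc) := hacyc
  have link : ∀ X ⊆ CompEdge Gc p₁ \ CompEdge Gc p₂, s ≤ X.ncard →
      ∃ x ∈ X, ∃ y ∈ CompEdge Gc p₂ \ CompEdge Gc p₁,
        ∃ m, x ∈ CompEdge Gc m ∧ y ∈ CompEdge Gc m := by
    intro X hX hs
    have hd := hE.ncard_le_ncard_diff_add_one (Ne.symm hne)
    obtain ⟨x, hx, y, hy, hxy⟩ := hG X (CompEdge Gc p₂ \ CompEdge Gc p₁)
      (Set.disjoint_left.mpr fun a ha hb => hb.2 (hX ha).1) hs (by omega)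
    exact ⟨x, hx, y, hy, hS.exists_compEdge hcol hxy
      (hS.notMem_of_mem_compEdge hcol (by omega) (hX hx).1)
      (hS.notMem_of_mem_compEdge hcol (by omega) hy.1)⟩
  have hd := hE.ncard_le_ncard_diff_add_one hne
  obtain ⟨x, hx, y, hy, m, hxm, hym⟩ := link _ subset_rfl (by omega)
  have hdx := Set.ncard_sdiff_singleton_add_one hx
  obtain ⟨x', hx', y', hy', m', hxm', hym'⟩ := link _ Set.sdiff_subset
    (show s ≤ ((CompEdge Gc p₁ \ CompEdge Gc p₂) \ {x}).ncard by omega)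
  exact hx'.2 (hE.eq_of_link hne hx hy hxm hym hx'.1 hy' hxm' hym').symm
end
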